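/- Let $H$ be a $(d+1)$-uniform hypergraph. Then the number of integer points of the hypergraphic zonotope $\mathcal{Z}_H$ (points of $Z_{d-1}(H;\mathbb{Z})$ lying in $\mathcal{Z}_H$) equals $\sum_F |\tilde H_{d-1}(F;\mathbb{Z})_{\mathrm{tors}}|$, summed over all spanning hyperforests $F$ of $H$ (including the empty hyperforest). -/

import Mathlib

open Finset

variable {V : Type} [Fintype V] [LinearOrder V]

/-- Incidence number between a simplex `σ` and a codimension-one face `τ`:
`(-1)^i` where `i` is the position of the vertex `σ \ τ` in the increasing
ordering of `σ`, and `0` if `τ` is not a codimension-one face of `σ`. -/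
def inc (σ τ : Finset V) : ℤ :=
  if τ ⊆ σ ∧ σ.card = τ.card + 1 then
    ∑ v ∈ σ \ τ, (-1 : ℤ) ^ ((σ.filter (fun x => x < v)).card)
  else 0

/-- The augmented chain group of the simplicial complex `S` in (augmented) degree `k`:
the free module on the simplices of `S` having `k` vertices (so `k = 0` corresponds to
the empty simplex, and geometric dimension `k - 1`).  A basis simplex corresponds to the
oriented simplex `(v_0 v_1 ⋯)` with vertices listed in increasing order. -/
abbrev Chain (R : Type) [CommRing R] (S : Finset (Finset V)) (k : ℕ) : Type :=
  {σ : Finset V // σ ∈ S ∧ σ.card = k} → R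

/-- The simplicial boundary map (augmented: in lowest degree it is the augmentation
sending every vertex to `1`).  `bdry R S k : C_k → C_{k-1}` in the usual (geometric)
indexing of the paper. -/
def bdry (R : Type) [CommRing R] (S : Finset (Finset V)) (k : ℕ) :
    Chain R S (k + 1) →ₗ[R] Chain R S k :=
  LinearMap.pi fun τ => ∑ σ : {σ : Finset V // σ ∈ S ∧ σ.card = k + 1},
    (inc σ.1 τ.1 : R) • LinearMap.proj σ

/-- `S` is (the set of simplices of) a simplicial complex with vertex set `V`,
augmented with the empty simplex. -/
def IsComplex (S : Finset (Finset V)) : Prop :=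
  ∅ ∈ S ∧ (∀ σ ∈ S, ∀ τ ⊆ σ, τ ∈ S) ∧ ∀ v : V, {v} ∈ S

/-- The simplicial complex associated to a `(d+1)`-uniform hypergraph with edge set `E`:
the full `(d-1)`-skeleton on the vertex set together with the edges. -/
def cx (E : Finset (Finset V)) (d : ℕ) : Finset (Finset V) :=
  univ.filter (fun σ : Finset V => σ.card ≤ d) ∪ E

/-- The complex of the complete `(d+1)`-uniform hypergraph on `n` vertices. -/
def completeCx (n d : ℕ) : Finset (Finset (Fin n)) :=
  univ.filter (fun σ : Finset (Fin n) => σ.card ≤ d + 1)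

/-- Coefficientwise inclusion of integral chains into real chains. -/
def castChain (S : Finset (Finset V)) (k : ℕ) : Chain ℤ S k →ₗ[ℤ] Chain ℝ S k :=
  LinearMap.pi fun τ => ((Int.castAddHom ℝ).toIntLinearMap).comp (LinearMap.proj τ)

/-- The hypergraphic zonotope `𝒵_H ⊆ Z_{d-1}(H; ℝ) ⊆ C_{d-1}(H; ℝ)` of a
`(d+1)`-uniform hypergraph with edge set `E` (here `d = k + 1`): the Minkowski sum of
the segments `conv {0, ∂_d((v₀v₁⋯v_d))}` over the edges of `H` (one segment per edge,
the edge ordered increasingly). -/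
noncomputable def hZonotope (E : Finset (Finset V)) (k : ℕ) :
    Set (Chain ℝ (cx E (k + 1)) (k + 1)) :=
  {x | ∃ c : {σ : Finset V // σ ∈ cx E (k + 1) ∧ σ.card = k + 2} → ℝ,
    (∀ σ, c σ ∈ Set.Icc (0 : ℝ) 1) ∧
    x = ∑ σ, c σ • bdry ℝ (cx E (k + 1)) (k + 1) (Pi.single σ 1)}

/-- The cardinality of the torsion subgroup of
`H̃_{d-1}(F; ℤ) = Z_{d-1}(F; ℤ)/B_{d-1}(F; ℤ)` for the `(d+1)`-uniform hypergraph
with edge set `F`, where `d = k + 1`. -/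
noncomputable def cardTorsionH (F : Finset (Finset V)) (k : ℕ) : ℕ :=
  Nat.card (Submodule.torsion ℤ
    (LinearMap.ker (bdry ℤ (cx F (k + 1)) k) ⧸
      Submodule.comap (LinearMap.ker (bdry ℤ (cx F (k + 1)) k)).subtype
        (LinearMap.range (bdry ℤ (cx F (k + 1)) (k + 1)))))

/-- The points `x` of `Λ` some positive multiple `m • x` of which is a combination
`∑ i ∈ A, a i • v i` with coefficients in `[0, m]`: the points of `Λ` whose image in
`Λ ⊗ ℚ` lies in the zonotope spanned by the vectors `v i`, `i ∈ A`. -/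
def zonotopePoints {ι Λ : Type*} [AddCommGroup Λ] (v : ι → Λ) (A : Finset ι) :
    Set Λ :=
  {x | ∃ m : ℤ, 0 < m ∧ ∃ a : ι → ℤ, (∀ i ∈ A, 0 ≤ a i ∧ a i ≤ m) ∧
    m • x = ∑ i ∈ A, a i • v i}

section ZonotopePoints

variable {ι Λ : Type*} [AddCommGroup Λ] {v : ι → Λ} {A : Finset ι} {j : ι}

theorem mem_zonotopePoints_insert [DecidableEq ι] (hj : j ∉ A) {x : Λ} :
    x ∈ zonotopePoints v (insert j A) ↔ ∃ m : ℤ, 0 < m ∧ ∃ (a : ι → ℤ) (t : ℤ),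
      (∀ i ∈ A, 0 ≤ a i ∧ a i ≤ m) ∧ 0 ≤ t ∧ t ≤ m ∧
      m • x = ∑ i ∈ A, a i • v i + t • v j := by
  constructor
  · rintro ⟨m, hm, a, ha, h⟩
    refine ⟨m, hm, a, a j, fun i hi => ha i (mem_insert_of_mem hi),
      (ha j (mem_insert_self j A)).1, (ha j (mem_insert_self j A)).2, ?_⟩
    rw [h, sum_insert hj, add_comm]
  · rintro ⟨m, hm, a, t, ha, ht, htm, h⟩
    refine ⟨m, hm, Function.update a j t, fun i hi => ?_, ?_⟩
    · rcases eq_or_ne i j with rfl | hij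
      · simpa using ⟨ht, htm⟩
      · simpa [hij] using ha i ((mem_insert.1 hi).resolve_left hij)
    · rw [h, sum_insert hj, Function.update_self, add_comm]
      congr 1
      refine sum_congr rfl fun i hi => ?_
      rw [Function.update_of_ne (ne_of_mem_of_not_mem hi hj)]

theorem zonotopePoints_subset_insert [DecidableEq ι] (hj : j ∉ A) :
    zonotopePoints v A ⊆ zonotopePoints v (insert j A) := by
  rintro x ⟨m, hm, a, ha, h⟩
  exact (mem_zonotopePoints_insert hj).2 ⟨m, hm, a, 0, ha, le_rfl, hm.le, by simp [h]⟩

theorem zonotopePoints_insert_of_torsion [DecidableEq ι] (hj : j ∉ A) {n : ℤ} (hn : n ≠ 0)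
    (hv : n • v j = 0) : zonotopePoints v (insert j A) = zonotopePoints v A := by
  refine Set.Subset.antisymm ?_ (zonotopePoints_subset_insert hj)
  intro x hx
  obtain ⟨m, hm, a, t, ha, -, -, h⟩ := (mem_zonotopePoints_insert hj).1 hx
  have hn2 : 0 < n * n := mul_self_pos.2 hn
  refine ⟨n * n * m, mul_pos hn2 hm, fun i => n * n * a i, fun i hi => ⟨?_, ?_⟩, ?_⟩
  · exact mul_nonneg hn2.le (ha i hi).1
  · exact mul_le_mul_of_nonneg_left (ha i hi).2 hn2.le
  · have h1 : (n * n) • t • v j = 0 := by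
      rw [smul_comm, mul_smul, hv, smul_zero, smul_zero]
    simp only [mul_smul (n * n)]
    rw [h, smul_add, h1, add_zero, smul_sum]

theorem mem_zonotopePoints_of_add_smul_mem_insert [DecidableEq ι] (hj : j ∉ A) {x : Λ} {s : ℤ}
    (hs : 0 < s) (hx : x ∈ zonotopePoints v (insert j A))
    (hy : x + s • v j ∈ zonotopePoints v (insert j A)) : x ∈ zonotopePoints v A := by
  obtain ⟨m, hm, a, t, ha, ht, htm, h⟩ := (mem_zonotopePoints_insert hj).1 hx
  obtain ⟨n, hn, b, u, hb, hu, hun, h'⟩ := (mem_zonotopePoints_insert hj).1 hy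
  have hp : 0 ≤ n * s - u := by nlinarith
  have h2 : n • x = ∑ i ∈ A, b i • v i - (n * s - u) • v j := by
    have : n • x = n • (x + s • v j) - (n * s) • v j := by module
    rw [this, h']
    module
  rcases ht.eq_or_lt with rfl | ht
  · exact ⟨m, hm, a, ha, by simpa using h⟩
  refine ⟨(n * s - u) * m + t * n, by positivity, fun i => (n * s - u) * a i + t * b i,
    fun i hi => ⟨?_, ?_⟩, ?_⟩
  · have := ha i hi
    have := hb i hi
    have := mul_nonneg hp (ha i hi).1
    have := mul_nonneg ht.le (hb i hi).1
    linarith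
  · have := mul_le_mul_of_nonneg_left (ha i hi).2 hp
    have := mul_le_mul_of_nonneg_left (hb i hi).2 ht.le
    linarith
  · simp only [add_smul, mul_smul _ m, mul_smul t, sum_add_distrib, mul_smul (n * s - u)]
    rw [h, h2, ← smul_sum, ← smul_sum]
    module

theorem bijOn_mk'_zonotopePoints_diff [DecidableEq ι] (hj : j ∉ A)
    (hv : ∀ n : ℤ, n • v j = 0 → n = 0) (hfin : (zonotopePoints v A).Finite) :
    Set.BijOn (QuotientAddGroup.mk' (AddSubgroup.zmultiples (v j)))
      (zonotopePoints v (insert j A) \ zonotopePoints v A)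
      (zonotopePoints (fun i => QuotientAddGroup.mk' (AddSubgroup.zmultiples (v j)) (v i)) A) := by
  have key : ∀ x y : Λ, QuotientAddGroup.mk' (AddSubgroup.zmultiples (v j)) x =
      QuotientAddGroup.mk' (AddSubgroup.zmultiples (v j)) y →
      ∃ s : ℤ, y = x + s • v j := by
    intro x y hxy
    rw [QuotientAddGroup.mk'_eq_mk'] at hxy
    obtain ⟨z, hz, rfl⟩ := hxy
    obtain ⟨s, rfl⟩ := AddSubgroup.mem_zmultiples_iff.1 hz
    exact ⟨s, rfl⟩
  have hvj : QuotientAddGroup.mk' (AddSubgroup.zmultiples (v j)) (v j) = 0 := by simp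
  refine ⟨?_, ?_, ?_⟩
  · rintro x ⟨hx, -⟩
    obtain ⟨m, hm, a, t, ha, -, -, h⟩ := (mem_zonotopePoints_insert hj).1 hx
    refine ⟨m, hm, a, ha, ?_⟩
    rw [← map_zsmul, h]
    simp only [map_add, map_sum, map_zsmul, hvj, smul_zero, add_zero]
  · rintro x ⟨hx, hx'⟩ y ⟨hy, hy'⟩ hxy
    obtain ⟨s, rfl⟩ := key x y hxy
    rcases lt_trichotomy s 0 with hs | rfl | hs
    · refine absurd (mem_zonotopePoints_of_add_smul_mem_insert hj (s := -s) (by omega) hy ?_) hy'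
      rwa [show x + s • v j + (-s) • v j = x by module]
    · simp
    · exact absurd (mem_zonotopePoints_of_add_smul_mem_insert hj hs hx hy) hx'
  · rintro z ⟨m, hm, a, ha, h⟩
    obtain ⟨x, rfl⟩ := QuotientAddGroup.mk'_surjective (AddSubgroup.zmultiples (v j)) z
    obtain ⟨p, hp⟩ := key (∑ i ∈ A, a i • v i) (m • x) (by simp only [map_sum, map_zsmul, h])
    have hex : ∃ n : ℕ, x + (-(p / m) + n) • v j ∉ zonotopePoints v A := by
      by_contra! hall
      refine Set.infinite_of_injective_forall_mem (fun n n' hnn => ?_) hall hfin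
      have h0 : ((n : ℤ) - n') • v j = 0 := by
        have : ((n : ℤ) - n') • v j =
            (x + (-(p / m) + n) • v j) - (x + (-(p / m) + n') • v j) := by module
        rw [this, sub_eq_zero]
        exact hnn
      have := hv _ h0
      omega
    classical
    refine ⟨x + (-(p / m) + Nat.find hex) • v j, ⟨?_, Nat.find_spec hex⟩, ?_⟩
    · rw [mem_zonotopePoints_insert hj]
      rcases hn : Nat.find hex with _ | n
      · refine ⟨m, hm, a, p % m, ha, Int.emod_nonneg _ hm.ne', (Int.emod_lt_of_pos _ hm).le, ?_⟩
        have : p % m = p - m * (p / m) := by have := Int.mul_ediv_add_emod p m; omega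
        rw [this, smul_add, hp]
        push_cast
        module
      · obtain ⟨q, hq, b, hb, hqb⟩ := not_not.1 (Nat.find_min hex (m := n) (by omega))
        refine ⟨q, hq, b, q, hb, hq.le, le_rfl, ?_⟩
        rw [← hqb]
        push_cast
        module
    · rw [map_add, map_zsmul, hvj, smul_zero, add_zero]

theorem independent_insert_iff_mk' [DecidableEq ι] (hj : j ∉ A)
    (hv : ∀ n : ℤ, n • v j = 0 → n = 0) :
    (∀ c : ι → ℤ, ∑ i ∈ insert j A, c i • v i = 0 → ∀ i ∈ insert j A, c i = 0) ↔
      ∀ c : ι → ℤ, ∑ i ∈ A, c i • QuotientAddGroup.mk' (AddSubgroup.zmultiples (v j)) (v i) = 0 →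
        ∀ i ∈ A, c i = 0 := by
  have hvj : QuotientAddGroup.mk' (AddSubgroup.zmultiples (v j)) (v j) = 0 := by simp
  constructor
  · intro h c hc
    have : QuotientAddGroup.mk' (AddSubgroup.zmultiples (v j)) (∑ i ∈ A, c i • v i) = 0 := by
      simpa only [map_sum, map_zsmul] using hc
    rw [QuotientAddGroup.mk'_apply, QuotientAddGroup.eq_zero_iff,
      AddSubgroup.mem_zmultiples_iff] at this
    obtain ⟨s, hs⟩ := this
    intro i hi
    have h1 := h (Function.update c j (-s)) ?_ i (mem_insert_of_mem hi)
    · rwa [Function.update_of_ne (ne_of_mem_of_not_mem hi hj)] at h1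
    · rw [sum_insert hj, Function.update_self, neg_smul, hs, neg_add_eq_zero]
      refine sum_congr rfl fun i hi => ?_
      rw [Function.update_of_ne (ne_of_mem_of_not_mem hi hj)]
  · intro h c hc
    rw [sum_insert hj] at hc
    have hA : ∀ i ∈ A, c i = 0 := by
      refine h c ?_
      have := congrArg (QuotientAddGroup.mk' (AddSubgroup.zmultiples (v j))) hc
      simpa only [map_add, map_sum, map_zsmul, hvj, smul_zero, zero_add, map_zero] using this
    rw [sum_eq_zero fun i hi => by rw [hA i hi, zero_smul], add_zero] at hc
    intro i hi
    rcases mem_insert.1 hi with rfl | hi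
    · exact hv _ hc
    · exact hA i hi

end ZonotopePoints

theorem card_torsion_congr {M N : Type*} [AddCommGroup M] [AddCommGroup N] (e : M ≃+ N) :
    Nat.card (AddCommGroup.torsion M) = Nat.card (AddCommGroup.torsion N) :=
  Nat.card_congr (e.toEquiv.subtypeEquiv fun _ =>
    (Function.Injective.isOfFinAddOrder_iff (f := e.toAddMonoidHom) e.injective).symm)

/-- The quotient by the subgroup generated by `insert j A`, computed in two steps. -/
theorem card_torsion_quotient_closure_insert {ι Λ : Type*} [DecidableEq ι] [AddCommGroup Λ]
    (v : ι → Λ) (A : Finset ι) (j : ι) :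
    Nat.card (AddCommGroup.torsion
        (Λ ⧸ AddSubgroup.closure (v '' (insert j A : Finset ι)))) =
      Nat.card (AddCommGroup.torsion ((Λ ⧸ AddSubgroup.zmultiples (v j)) ⧸ AddSubgroup.closure
        ((fun i => QuotientAddGroup.mk' (AddSubgroup.zmultiples (v j)) (v i)) ''
          (A : Set ι)))) := by
  have hle : AddSubgroup.zmultiples (v j) ≤
      AddSubgroup.closure (v '' (insert j A : Finset ι)) := by
    rw [AddSubgroup.zmultiples_le]
    exact AddSubgroup.subset_closure (Set.mem_image_of_mem v (mem_insert_self j A))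
  have hmap : AddSubgroup.map (QuotientAddGroup.mk' (AddSubgroup.zmultiples (v j)))
      (AddSubgroup.closure (v '' (insert j A : Finset ι))) = AddSubgroup.closure
        ((fun i => QuotientAddGroup.mk' (AddSubgroup.zmultiples (v j)) (v i)) '' (A : Set ι)) := by
    have hvj : QuotientAddGroup.mk' (AddSubgroup.zmultiples (v j)) (v j) = 0 := by simp
    rw [AddMonoidHom.map_closure, coe_insert, Set.image_insert_eq, Set.image_insert_eq, hvj,
      AddSubgroup.closure_insert_zero, Set.image_image]
  exact card_torsion_congr ((QuotientAddGroup.quotientQuotientEquivQuotient _ _ hle).symm.trans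
    (QuotientAddGroup.quotientAddEquivOfEq hmap))

theorem finite_torsion_of_fg (Λ : Type*) [AddCommGroup Λ] [AddGroup.FG Λ] :
    Finite (AddCommGroup.torsion Λ) := by
  have : Module.Finite ℤ Λ := Module.Finite.iff_addGroup_fg.2 inferInstance
  have : AddGroup.FG (AddCommGroup.torsion Λ) := by
    rw [AddGroup.fg_iff_addSubgroup_fg]
    exact (Submodule.fg_iff_addSubgroup_fg
      (AddSubgroup.toIntSubmodule (AddCommGroup.torsion Λ))).1 (IsNoetherian.noetherian _)
  exact AddCommGroup.finite_of_fg_isAddTorsion _ AddCommMonoid.addTorsion.isAddTorsion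

open scoped Classical in
/-- The number of lattice points of a lattice zonotope is the sum of the numbers of torsion
elements of the quotients by the linearly independent sets of generators. -/
theorem ncard_zonotopePoints.{u} {ι : Type*} (A : Finset ι) :
    ∀ {Λ : Type u} [AddCommGroup Λ] [AddGroup.FG Λ] (v : ι → Λ),
      (zonotopePoints v A).Finite ∧ (zonotopePoints v A).ncard =
        ∑ F ∈ A.powerset, if ∀ c : ι → ℤ, ∑ i ∈ F, c i • v i = 0 → ∀ i ∈ F, c i = 0 then
          Nat.card (AddCommGroup.torsion (Λ ⧸ AddSubgroup.closure (v '' (F : Set ι)))) else 0 := by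
  induction A using Finset.induction_on with
  | empty =>
    intro Λ _ _ v
    have h : zonotopePoints v ∅ = AddCommGroup.torsion Λ := by
      ext x
      have : x ∈ (AddCommGroup.torsion Λ : Set Λ) ↔ IsOfFinAddOrder x := Iff.rfl
      rw [this, isOfFinAddOrder_iff_zsmul_eq_zero]
      simp only [zonotopePoints, sum_empty, notMem_empty, IsEmpty.forall_iff, implies_true,
        true_and, exists_const, Set.mem_ofPred_eq]
      constructor
      · rintro ⟨m, hm, h⟩
        exact ⟨m, hm.ne', h⟩
      · rintro ⟨m, hm, h⟩
        exact ⟨m * m, mul_self_pos.2 hm, by rw [mul_smul, h, smul_zero]⟩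
    have := finite_torsion_of_fg Λ
    refine ⟨h ▸ Set.toFinite _, ?_⟩
    rw [h, powerset_empty, sum_singleton, if_pos (by simp), coe_empty, Set.image_empty,
      AddSubgroup.closure_empty]
    exact card_torsion_congr QuotientAddGroup.quotientBot.symm
  | insert j A hj ih =>
    intro Λ _ _ v
    rw [sum_powerset_insert hj]
    by_cases hv : ∀ n : ℤ, n • v j = 0 → n = 0
    · have hbij := bijOn_mk'_zonotopePoints_diff hj hv (ih v).1
      obtain ⟨hfin, hcard⟩ := ih fun i => QuotientAddGroup.mk' (AddSubgroup.zmultiples (v j)) (v i)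
      have hdiff : (zonotopePoints v (insert j A) \ zonotopePoints v A).Finite :=
        hbij.finite_iff_finite.2 hfin
      have hunion := Set.sdiff_union_of_subset (zonotopePoints_subset_insert (v := v) hj)
      refine ⟨hunion ▸ hdiff.union (ih v).1, ?_⟩
      rw [← hunion, Set.ncard_union_eq Set.disjoint_sdiff_left hdiff (ih v).1, (ih v).2, add_comm,
        ← hbij.injOn.ncard_image, hbij.image_eq, hcard]
      congr 1
      refine sum_congr rfl fun F hF => ?_
      have hjF : j ∉ F := fun h => hj (mem_powerset.1 hF h)
      simp only [independent_insert_iff_mk' hjF hv, card_torsion_quotient_closure_insert]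
    · push Not at hv
      obtain ⟨n, hn, hn0⟩ := hv
      rw [zonotopePoints_insert_of_torsion hj hn0 hn]
      refine ⟨(ih v).1, ?_⟩
      rw [(ih v).2, left_eq_add]
      refine sum_eq_zero fun F hF => if_neg fun h => hn0 ?_
      have hjF : j ∉ F := fun h => hj (mem_powerset.1 hF h)
      have := h (fun i => if i = j then n else 0) ?_ j (mem_insert_self j F)
      · simpa using this
      · simp [hn]

theorem tendsto_floor_mul_natCast_div_atTop (x : ℝ) :
    Filter.Tendsto (fun N : ℕ => (⌊x * N⌋ : ℝ) / N) Filter.atTop (nhds x) := by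
  refine tendsto_of_tendsto_of_tendsto_of_le_of_le'
    (g := fun N : ℕ => x - 1 / (N : ℝ)) (h := fun _ => x) ?_ tendsto_const_nhds ?_ ?_
  · simpa using tendsto_const_nhds.sub (tendsto_one_div_atTop_nhds_zero_nat (𝕜 := ℝ))
  all_goals
    filter_upwards [Filter.eventually_gt_atTop 0] with N hN
    have hN' : (0 : ℝ) < N := by exact_mod_cast hN
  · rw [le_div_iff₀ hN', sub_mul, one_div_mul_cancel hN'.ne']
    exact (Int.sub_one_lt_floor _).le
  · rw [div_le_iff₀ hN']
    exact Int.floor_le _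

/-- Finitely many positive reals stay positive under some `ℚ`-linear functional, which can be
chosen integral on any given finite set. -/
theorem exists_rat_functional_pos (T U : Finset ℝ) (hT : ∀ x ∈ T, 0 < x) :
    ∃ f : ℝ →ₗ[ℚ] ℚ, (∀ x ∈ T, 0 < f x) ∧ ∀ x ∈ U, ∃ n : ℤ, f x = n := by
  let B := Module.Basis.ofVectorSpace ℚ ℝ
  let g : ℕ → ℝ →ₗ[ℚ] ℚ := fun N => B.constr ℚ fun b => (⌊B b * N⌋ : ℚ) / N
  have hlim : ∀ x : ℝ, Filter.Tendsto (fun N => (g N x : ℝ)) Filter.atTop (nhds x) := by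
    intro x
    have h1 : ∀ N, (g N x : ℝ) =
        ∑ b ∈ (B.repr x).support, (B.repr x b : ℝ) * ((⌊B b * N⌋ : ℝ) / N) := by
      intro N
      simp only [g, B.constr_apply, Finsupp.sum, smul_eq_mul]
      push_cast
      rfl
    have h2 : x = ∑ b ∈ (B.repr x).support, (B.repr x b : ℝ) * B b := by
      conv_lhs => rw [← B.linearCombination_repr x]
      simp only [Finsupp.linearCombination_apply, Finsupp.sum, Rat.smul_def]
    simp only [h1]
    conv => rhs; rw [h2]
    refine tendsto_finsetSum _ fun b _ => Filter.Tendsto.const_mul _ ?_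
    exact tendsto_floor_mul_natCast_div_atTop (B b)
  have hev : ∀ᶠ N in Filter.atTop, ∀ x ∈ T, 0 < g N x := by
    rw [Filter.eventually_all_finset]
    intro x hx
    filter_upwards [(hlim x).eventually (lt_mem_nhds (hT x hx))] with N hN
    exact_mod_cast hN
  obtain ⟨N, hN⟩ := hev.exists
  have hpos : (0 : ℚ) < ∏ y ∈ U, ((g N y).den : ℚ) :=
    prod_pos fun y _ => by exact_mod_cast (g N y).den_pos
  refine ⟨(∏ y ∈ U, ((g N y).den : ℚ)) • g N, fun x hx => ?_, fun x hx => ?_⟩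
  · exact mul_pos hpos (hN x hx)
  · refine ⟨(∏ y ∈ U.erase x, ((g N y).den : ℤ)) * (g N x).num, ?_⟩
    rw [LinearMap.smul_apply, smul_eq_mul, ← mul_prod_erase U _ hx]
    push_cast
    rw [← Rat.mul_den_eq_num (g N x)]
    ring

theorem exists_real_coeff_iff_exists_int_coeff {ι J : Type*} (w : ι → J → ℤ) (A : Finset ι)
    (z : J → ℤ) :
    (∃ c : ι → ℝ, (∀ i ∈ A, c i ∈ Set.Icc (0 : ℝ) 1) ∧
      ∀ j, (z j : ℝ) = ∑ i ∈ A, c i * w i j) ↔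
    ∃ m : ℤ, 0 < m ∧ ∃ a : ι → ℤ, (∀ i ∈ A, 0 ≤ a i ∧ a i ≤ m) ∧
      ∀ j, m * z j = ∑ i ∈ A, a i * w i j := by
  classical
  constructor
  · rintro ⟨c, hc, h⟩
    obtain ⟨f, hfpos, hfint⟩ := exists_rat_functional_pos
      ((insert 1 (A.image c ∪ A.image fun i => 1 - c i)).filter (0 < ·))
      (insert 1 (A.image c)) (fun x hx => (mem_filter.1 hx).2)
    have hnonneg : ∀ x ∈ insert 1 (A.image c ∪ A.image fun i => 1 - c i), 0 ≤ x → 0 ≤ f x := by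
      intro x hx h0
      rcases h0.eq_or_lt with rfl | h0
      · simp
      · exact (hfpos x (mem_filter.2 ⟨hx, h0⟩)).le
    obtain ⟨m, hm⟩ := hfint 1 (mem_insert_self _ _)
    have hint : ∀ i, ∃ n : ℤ, i ∈ A → f (c i) = n := by
      intro i
      by_cases hi : i ∈ A
      · obtain ⟨n, hn⟩ := hfint (c i) (mem_insert_of_mem (mem_image_of_mem c hi))
        exact ⟨n, fun _ => hn⟩
      · exact ⟨0, fun h => absurd h hi⟩
    choose a ha using hint
    refine ⟨m, ?_, a, fun i hi => ⟨?_, ?_⟩, fun j => ?_⟩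
    · have := hfpos 1 (by simp)
      rw [hm] at this
      exact_mod_cast this
    · have := hnonneg (c i) (by simp only [mem_insert, mem_union, mem_image]; grind) (hc i hi).1
      rw [ha i hi] at this
      exact_mod_cast this
    · have := hnonneg (1 - c i) (by simp only [mem_insert, mem_union, mem_image]; grind)
        (sub_nonneg.2 (hc i hi).2)
      rw [map_sub, ha i hi, hm, sub_nonneg] at this
      exact_mod_cast this
    · have h1 : (z j : ℚ) • (1 : ℝ) = ∑ i ∈ A, (w i j : ℚ) • c i := by
        simp only [Rat.smul_def, Rat.cast_intCast, mul_one, h j]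
        exact sum_congr rfl fun i _ => mul_comm _ _
      have h2 := congrArg f h1
      simp only [map_smul, map_sum, hm, smul_eq_mul] at h2
      rw [sum_congr rfl fun i hi => by rw [ha i hi, mul_comm]] at h2
      rw [mul_comm]
      exact_mod_cast h2
  · rintro ⟨m, hm, a, ha, h⟩
    have hm' : (0 : ℝ) < m := by exact_mod_cast hm
    refine ⟨fun i => a i / m, fun i hi => ⟨?_, ?_⟩, fun j => ?_⟩
    · exact div_nonneg (by exact_mod_cast (ha i hi).1) hm'.le
    · rw [div_le_one hm']
      exact_mod_cast (ha i hi).2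
    · have h1 : (m : ℝ) * z j = ∑ i ∈ A, (a i : ℝ) * w i j := by exact_mod_cast h j
      rw [eq_div_of_mul_eq hm'.ne' ((mul_comm _ _).trans h1), sum_div]
      exact sum_congr rfl fun i _ => by ring

theorem forall_real_coeff_iff_forall_int_coeff {ι J : Type*} (w : ι → J → ℤ) (A : Finset ι) :
    (∀ c : ι → ℝ, (∀ j, ∑ i ∈ A, c i * w i j = 0) → ∀ i ∈ A, c i = 0) ↔
    ∀ a : ι → ℤ, (∀ j, ∑ i ∈ A, a i * w i j = 0) → ∀ i ∈ A, a i = 0 := by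
  classical
  constructor
  · intro h a ha i hi
    exact_mod_cast h (fun i => a i) (fun j => by exact_mod_cast ha j) i hi
  · intro h c hc i hi
    by_contra hne
    obtain ⟨f, hfpos, hfint⟩ := exists_rat_functional_pos {|c i|} (A.image c) (by simpa using hne)
    have hint : ∀ i, ∃ n : ℤ, i ∈ A → f (c i) = n := by
      intro i
      by_cases hi : i ∈ A
      · obtain ⟨n, hn⟩ := hfint (c i) (mem_image_of_mem c hi)
        exact ⟨n, fun _ => hn⟩
      · exact ⟨0, fun h => absurd h hi⟩
    choose a ha using hint
    have h0 : a i = 0 := by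
      refine h a (fun j => ?_) i hi
      have h1 : ∑ i ∈ A, (w i j : ℚ) • c i = 0 := by
        rw [← hc j]
        simp only [Rat.smul_def, Rat.cast_intCast]
        exact sum_congr rfl fun i _ => mul_comm _ _
      have h2 := congrArg f h1
      simp only [map_smul, map_sum, smul_eq_mul, map_zero] at h2
      rw [sum_congr rfl fun i hi => by rw [ha i hi, mul_comm]] at h2
      exact_mod_cast h2
    have hfc : f (c i) = 0 := by rw [ha i hi, h0, Int.cast_zero]
    have := hfpos |c i| (by simp)
    rcases abs_choice (c i) with hab | hab <;> simp [hab, hfc] at this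

theorem card_submodule_torsion_int {M : Type*} [AddCommGroup M] [Module ℤ M] :
    Nat.card (Submodule.torsion ℤ M) = Nat.card (AddCommGroup.torsion M) := by
  refine Nat.card_congr (Equiv.subtypeEquivRight fun x => ?_)
  change _ ↔ IsOfFinAddOrder x
  rw [isOfFinAddOrder_iff_zsmul_eq_zero, Submodule.mem_torsion_iff]
  constructor
  · rintro ⟨⟨m, hm⟩, h⟩
    refine ⟨m, nonZeroDivisors.ne_zero hm, ?_⟩
    rw [← Int.cast_smul_eq_zsmul ℤ]
    exact h
  · rintro ⟨m, hm, h⟩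
    refine ⟨⟨m, mem_nonZeroDivisors_of_ne_zero hm⟩, ?_⟩
    rw [← Int.cast_smul_eq_zsmul ℤ] at h
    exact h

section Boundary

theorem inc_eq_zero {W : Type} [LinearOrder W] {σ τ : Finset W}
    (h : ¬(τ ⊆ σ ∧ σ.card = τ.card + 1)) : inc σ τ = 0 :=
  if_neg h

theorem inc_insert {W : Type} [LinearOrder W] {τ : Finset W} {v : W} (hv : v ∉ τ) :
    inc (insert v τ) τ = (-1) ^ (τ.filter (· < v)).card := by
  rw [inc, if_pos ⟨subset_insert v τ, card_insert_of_notMem hv⟩, insert_sdiff_cancel hv,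
    sum_singleton, filter_insert, if_neg (lt_irrefl v)]

theorem inc_mul_inc_insert_insert {W : Type} [LinearOrder W] {ρ : Finset W} {a b : W}
    (ha : a ∉ ρ) (hb : b ∉ ρ) (hab : a < b) :
    inc (insert a (insert b ρ)) (insert a ρ) * inc (insert a ρ) ρ +
      inc (insert a (insert b ρ)) (insert b ρ) * inc (insert b ρ) ρ = 0 := by
  have h1 : a ∉ insert b ρ := by simp [hab.ne, ha]
  have h2 : b ∉ insert a ρ := by simp [hab.ne', hb]
  rw [inc_insert h1, inc_insert ha, inc_insert hb, insert_comm a b, inc_insert h2,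
    filter_insert, filter_insert, if_pos hab, if_neg hab.not_gt,
    card_insert_of_notMem (by simp [ha])]
  ring

theorem sum_inc_mul_inc (σ ρ : Finset V) : ∑ τ : Finset V, inc σ τ * inc τ ρ = 0 := by
  by_cases h : ρ ⊆ σ ∧ σ.card = ρ.card + 2
  · obtain ⟨hρ, hcard⟩ := h
    obtain ⟨a, b, hab, hsd⟩ : ∃ a b, a < b ∧ σ \ ρ = {a, b} := by
      have : (σ \ ρ).card = 2 := by rw [card_sdiff_of_subset hρ]; omega
      obtain ⟨a, b, hne, h⟩ := card_eq_two.1 this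
      rcases hne.lt_or_gt with hlt | hlt
      · exact ⟨a, b, hlt, h⟩
      · exact ⟨b, a, hlt, by rw [h, pair_comm]⟩
    have ha : a ∉ ρ := (mem_sdiff.1 (hsd ▸ mem_insert_self a {b})).2
    have hb : b ∉ ρ := (mem_sdiff.1 (hsd ▸ mem_insert_of_mem (mem_singleton_self b))).2
    have hσ : σ = insert a (insert b ρ) := by
      rw [← sdiff_union_of_subset hρ, hsd, insert_union, singleton_union]
    have hne : insert a ρ ≠ insert b ρ := fun h => by
      have : a ∈ insert b ρ := h ▸ mem_insert_self a ρ
      simp [hab.ne, ha] at this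
    rw [← sum_subset (subset_univ {insert a ρ, insert b ρ}), sum_pair hne, hσ]
    · exact inc_mul_inc_insert_insert ha hb hab
    · intro τ _ hτ
      by_contra hne0
      obtain ⟨h1, h2⟩ := not_not.1 fun h => (left_ne_zero_of_mul hne0) (inc_eq_zero h)
      obtain ⟨h3, h4⟩ := not_not.1 fun h => (right_ne_zero_of_mul hne0) (inc_eq_zero h)
      have hc : (τ \ ρ).card = 1 := by rw [card_sdiff_of_subset h3]; omega
      obtain ⟨c, hc⟩ := card_eq_one.1 hc
      have hτc : τ = insert c ρ := by
        rw [← sdiff_union_of_subset h3, hc, singleton_union]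
      have hcm : c ∈ σ \ ρ := sdiff_subset_sdiff h1 le_rfl (hc ▸ mem_singleton_self c)
      rw [hsd, mem_insert, mem_singleton] at hcm
      rcases hcm with rfl | rfl <;> simp [hτc] at hτ
  · refine sum_eq_zero fun τ _ => ?_
    by_contra hne0
    obtain ⟨h1, h2⟩ := not_not.1 fun h => (left_ne_zero_of_mul hne0) (inc_eq_zero h)
    obtain ⟨h3, h4⟩ := not_not.1 fun h => (right_ne_zero_of_mul hne0) (inc_eq_zero h)
    exact h ⟨h3.trans h1, by omega⟩

theorem bdry_apply (R : Type) [CommRing R] (S : Finset (Finset V)) (k : ℕ)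
    (x : Chain R S (k + 1)) (τ : {τ : Finset V // τ ∈ S ∧ τ.card = k}) :
    bdry R S k x τ = ∑ σ, (inc σ.1 τ.1 : R) * x σ := by
  simp [bdry]

theorem bdry_single_apply (R : Type) [CommRing R] (S : Finset (Finset V)) (k : ℕ)
    (σ : {σ : Finset V // σ ∈ S ∧ σ.card = k + 1}) (τ : {τ : Finset V // τ ∈ S ∧ τ.card = k}) :
    bdry R S k (Pi.single σ 1) τ = (inc σ.1 τ.1 : R) := by
  rw [bdry_apply, sum_eq_single σ] <;> simp +contextual

theorem mem_cx_of_card_le (F : Finset (Finset V)) {d : ℕ} {σ : Finset V} (h : σ.card ≤ d) :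
    σ ∈ cx F d := by
  simp [cx, h]

theorem mem_iff_mem_cx {F : Finset (Finset V)} {k : ℕ} (hF : ∀ e ∈ F, e.card = k + 2)
    (σ : Finset V) : σ ∈ F ↔ σ ∈ cx F (k + 1) ∧ σ.card = k + 2 := by
  constructor
  · exact fun h => ⟨by simp [cx, h], hF σ h⟩
  · rintro ⟨h, hσ⟩
    simpa [cx, hσ] using h

theorem bdry_inc_eq_zero (E : Finset (Finset V)) (k : ℕ) (σ : Finset V) :
    bdry ℤ (cx E (k + 1)) k (fun τ => inc σ τ.1) = 0 := by
  ext ρ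
  have hmem : ∀ τ : Finset V, τ ∈ univ.filter (fun τ : Finset V => τ.card = k + 1) ↔
      τ ∈ cx E (k + 1) ∧ τ.card = k + 1 := fun τ => by
    simpa using fun h : τ.card = k + 1 => mem_cx_of_card_le E h.le
  have hsupp : ∀ τ ∈ univ, τ ∉ univ.filter (fun τ : Finset V => τ.card = k + 1) →
      inc σ τ * inc τ ρ.1 = 0 := by
    intro τ _ hτ
    rw [inc_eq_zero (σ := τ), mul_zero]
    rintro ⟨-, h⟩
    exact hτ (by simp [h, ρ.2.2])
  rw [bdry_apply, Pi.zero_apply, ← sum_inc_mul_inc σ ρ.1,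
    ← sum_subset (subset_univ _) hsupp, sum_subtype _ hmem]
  exact sum_congr rfl fun τ _ => by simp [mul_comm]

/-- The boundary of the simplex `σ`, as a cycle. -/
def edgeCycle (E : Finset (Finset V)) (k : ℕ) (σ : Finset V) :
    LinearMap.ker (bdry ℤ (cx E (k + 1)) k) :=
  ⟨fun τ => inc σ τ.1, bdry_inc_eq_zero E k σ⟩

theorem sum_smul_edgeCycle_apply (E F : Finset (Finset V)) (k : ℕ) (a : Finset V → ℤ)
    (τ : {τ : Finset V // τ ∈ cx E (k + 1) ∧ τ.card = k + 1}) :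
    (∑ σ ∈ F, a σ • edgeCycle E k σ).1 τ = ∑ σ ∈ F, a σ * inc σ τ.1 := by
  have : (∑ σ ∈ F, a σ • edgeCycle E k σ).1 = ∑ σ ∈ F, a σ • (edgeCycle E k σ).1 := by
    simp
  rw [this, Finset.sum_apply]
  rfl

theorem bdry_eq_sum {R : Type} [CommRing R] {F : Finset (Finset V)} {k : ℕ}
    (hF : ∀ e ∈ F, e.card = k + 2) (c : Finset V → R)
    (τ : {τ : Finset V // τ ∈ cx F (k + 1) ∧ τ.card = k + 1}) :
    bdry R (cx F (k + 1)) (k + 1) (fun σ => c σ.1) τ = ∑ σ ∈ F, c σ * (inc σ τ.1 : R) := by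
  rw [bdry_apply, sum_subtype F (mem_iff_mem_cx hF)]
  exact sum_congr rfl fun σ _ => mul_comm _ _

theorem castChain_mem_hZonotope_iff {E : Finset (Finset V)} {k : ℕ}
    (hE : ∀ e ∈ E, e.card = k + 2) (z : Chain ℤ (cx E (k + 1)) (k + 1)) :
    castChain (cx E (k + 1)) (k + 1) z ∈ hZonotope E k ↔
      ∃ c : Finset V → ℝ, (∀ σ ∈ E, c σ ∈ Set.Icc (0 : ℝ) 1) ∧
        ∀ τ, (z τ : ℝ) = ∑ σ ∈ E, c σ * (inc σ τ.1 : ℝ) := by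
  have key : ∀ c : Finset V → ℝ,
      (castChain (cx E (k + 1)) (k + 1) z = ∑ σ : {σ : Finset V // σ ∈ cx E (k + 1) ∧
        σ.card = k + 2}, c σ.1 • bdry ℝ (cx E (k + 1)) (k + 1) (Pi.single σ 1)) ↔
      ∀ τ, (z τ : ℝ) = ∑ σ ∈ E, c σ * (inc σ τ.1 : ℝ) := by
    intro c
    rw [funext_iff]
    refine forall_congr' fun τ => ?_
    rw [Finset.sum_apply, sum_subtype E (mem_iff_mem_cx hE)]
    simp only [Pi.smul_apply, smul_eq_mul, bdry_single_apply]
    rfl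
  constructor
  · rintro ⟨c, hc, h⟩
    have hext := Subtype.val_injective.extend_apply c 0
    refine ⟨Function.extend Subtype.val c 0, fun σ hσ => ?_, (key _).1 ?_⟩
    · have := hext ⟨σ, (mem_iff_mem_cx hE σ).1 hσ⟩
      rw [this]
      exact hc _
    · simp only [hext]
      exact h
  · rintro ⟨c, hc, h⟩
    exact ⟨fun σ => c σ.1, fun σ => hc _ ((mem_iff_mem_cx hE σ.1).2 σ.2), (key c).2 h⟩

theorem mem_hZonotope_iff_mem_zonotopePoints {E : Finset (Finset V)} {k : ℕ}
    (hE : ∀ e ∈ E, e.card = k + 2) (z : LinearMap.ker (bdry ℤ (cx E (k + 1)) k)) :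
    castChain (cx E (k + 1)) (k + 1) z.1 ∈ hZonotope E k ↔
      z ∈ zonotopePoints (edgeCycle E k) E := by
  rw [castChain_mem_hZonotope_iff hE]
  refine (exists_real_coeff_iff_exists_int_coeff
    (fun σ (τ : {τ : Finset V // τ ∈ cx E (k + 1) ∧ τ.card = k + 1}) => inc σ τ.1) E z.1).trans ?_
  refine exists_congr fun m => and_congr_right fun _ => exists_congr fun a =>
    and_congr_right fun _ => ?_
  rw [Subtype.ext_iff, funext_iff]
  refine forall_congr' fun τ => ?_
  rw [sum_smul_edgeCycle_apply]
  rfl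

theorem ker_bdry_eq_bot_iff {F : Finset (Finset V)} (E : Finset (Finset V)) {k : ℕ}
    (hF : ∀ e ∈ F, e.card = k + 2) :
    LinearMap.ker (bdry ℝ (cx F (k + 1)) (k + 1)) = ⊥ ↔
      ∀ a : Finset V → ℤ, ∑ σ ∈ F, a σ • edgeCycle E k σ = 0 → ∀ σ ∈ F, a σ = 0 := by
  have h := forall_real_coeff_iff_forall_int_coeff
    (fun σ (τ : {τ : Finset V // τ ∈ cx E (k + 1) ∧ τ.card = k + 1}) => inc σ τ.1) F
  have hZ : ∀ a : Finset V → ℤ, ∑ σ ∈ F, a σ • edgeCycle E k σ = 0 ↔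
      ∀ τ : {τ : Finset V // τ ∈ cx E (k + 1) ∧ τ.card = k + 1},
        ∑ σ ∈ F, a σ * inc σ τ.1 = 0 := by
    intro a
    rw [Subtype.ext_iff, funext_iff]
    refine forall_congr' fun τ => ?_
    rw [sum_smul_edgeCycle_apply]
    rfl
  simp only [hZ]
  rw [← h, LinearMap.ker_eq_bot']
  have hR : ∀ c : Finset V → ℝ, bdry ℝ (cx F (k + 1)) (k + 1) (fun σ => c σ.1) = 0 ↔
      ∀ τ : {τ : Finset V // τ ∈ cx E (k + 1) ∧ τ.card = k + 1},
        ∑ σ ∈ F, c σ * (inc σ τ.1 : ℝ) = 0 := by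
    intro c
    rw [funext_iff]
    simp only [bdry_eq_sum hF c]
    exact ⟨fun h τ => h ⟨τ.1, mem_cx_of_card_le F τ.2.2.le, τ.2.2⟩,
      fun h τ => h ⟨τ.1, mem_cx_of_card_le E τ.2.2.le, τ.2.2⟩⟩
  constructor
  · intro h c hc σ hσ
    exact congrFun (h _ ((hR c).2 hc)) ⟨σ, (mem_iff_mem_cx hF σ).1 hσ⟩
  · intro h c hc
    have hext := Subtype.val_injective.extend_apply c 0
    have := h (Function.extend Subtype.val c 0) ((hR _).1 (by simpa only [hext] using hc))
    ext σ
    rw [← hext σ]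
    exact this σ.1 ((mem_iff_mem_cx hF σ.1).2 σ.2)

/-- Cycles in codimension one depend only on the common skeleton of the complexes. -/
def reindexCycle (E F : Finset (Finset V)) (k : ℕ) (x : LinearMap.ker (bdry ℤ (cx F (k + 1)) k)) :
    LinearMap.ker (bdry ℤ (cx E (k + 1)) k) :=
  ⟨fun τ => x.1 ⟨τ.1, mem_cx_of_card_le F τ.2.2.le, τ.2.2⟩, by
    ext ρ
    have h := congrFun x.2 ⟨ρ.1, mem_cx_of_card_le F (by have := ρ.2.2; omega), ρ.2.2⟩
    rw [bdry_apply] at h ⊢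
    refine Eq.trans ?_ h
    exact Fintype.sum_equiv (Equiv.subtypeEquivRight fun τ =>
      ⟨fun h => ⟨mem_cx_of_card_le F h.2.le, h.2⟩, fun h => ⟨mem_cx_of_card_le E h.2.le, h.2⟩⟩)
      _ _ fun τ => rfl⟩

/-- `reindexCycle` as an additive equivalence. -/
def reindexCycleEquiv (E F : Finset (Finset V)) (k : ℕ) :
    LinearMap.ker (bdry ℤ (cx F (k + 1)) k) ≃+ LinearMap.ker (bdry ℤ (cx E (k + 1)) k) where
  toFun := reindexCycle E F k
  invFun := reindexCycle F E k
  left_inv _ := rfl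
  right_inv _ := rfl
  map_add' _ _ := rfl

theorem map_reindexCycleEquiv {F : Finset (Finset V)} (E : Finset (Finset V)) {k : ℕ}
    (hF : ∀ e ∈ F, e.card = k + 2) :
    (Submodule.comap (LinearMap.ker (bdry ℤ (cx F (k + 1)) k)).subtype
      (LinearMap.range (bdry ℤ (cx F (k + 1)) (k + 1)))).toAddSubgroup.map
        (reindexCycleEquiv E F k : _ →+ _) =
      AddSubgroup.closure (edgeCycle E k '' (F : Set (Finset V))) := by
  refine le_antisymm ?_ ?_
  · rintro _ ⟨x, ⟨c, hc⟩, rfl⟩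
    have hext := Subtype.val_injective.extend_apply c 0
    have : reindexCycleEquiv E F k x =
        ∑ σ ∈ F, Function.extend Subtype.val c 0 σ • edgeCycle E k σ := by
      rw [Subtype.ext_iff, funext_iff]
      intro τ
      rw [sum_smul_edgeCycle_apply]
      have h1 := bdry_eq_sum hF (Function.extend Subtype.val c 0)
        ⟨τ.1, mem_cx_of_card_le F τ.2.2.le, τ.2.2⟩
      simp only [hext, Int.cast_id] at h1
      rw [← h1]
      exact (congrFun hc _).symm
    change reindexCycleEquiv E F k x ∈ _
    rw [this]
    exact sum_mem fun σ hσ => zsmul_mem (AddSubgroup.subset_closure (Set.mem_image_of_mem _ hσ)) _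
  · rw [AddSubgroup.closure_le]
    rintro _ ⟨σ, hσ, rfl⟩
    refine ⟨edgeCycle F k σ, ⟨Pi.single ⟨σ, (mem_iff_mem_cx hF σ).1 hσ⟩ 1, ?_⟩, rfl⟩
    ext τ
    rw [bdry_single_apply]
    rfl

theorem cardTorsionH_eq {F : Finset (Finset V)} (E : Finset (Finset V)) {k : ℕ}
    (hF : ∀ e ∈ F, e.card = k + 2) :
    cardTorsionH F k = Nat.card (AddCommGroup.torsion
      (LinearMap.ker (bdry ℤ (cx E (k + 1)) k) ⧸
        AddSubgroup.closure (edgeCycle E k '' (F : Set (Finset V))))) := by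
  rw [cardTorsionH, card_submodule_torsion_int]
  exact card_torsion_congr
    (QuotientAddGroup.congr _ _ (reindexCycleEquiv E F k) (map_reindexCycleEquiv E hF))

end Boundary

open scoped Classical in
/-- For a `(d+1)`-uniform hypergraph `H` (with `d = k + 1`), the
number of integer points of the hypergraphic zonotope `𝒵_H` — points of
`Z_{d-1}(H; ℤ)` lying in `𝒵_H` — equals `∑_F |H̃_{d-1}(F; ℤ)_tors|`, summed over all
spanning hyperforests `F ⊆ E(H)` (those `F` with `H̃_d(F; ℝ) = 0`, including
`F = ∅`). -/
theorem card_lattice_points_hZonotope (d k : ℕ) (hdk : d = k + 1)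
    (E : Finset (Finset V)) (hE : ∀ e ∈ E, e.card = d + 1) :
    Nat.card {z : Chain ℤ (cx E (k + 1)) (k + 1) //
        bdry ℤ (cx E (k + 1)) k z = 0 ∧ castChain (cx E (k + 1)) (k + 1) z ∈ hZonotope E k}
      = ∑ F ∈ E.powerset,
          if LinearMap.ker (bdry ℝ (cx F (k + 1)) (k + 1)) = ⊥
          then cardTorsionH F k else 0 := by
  subst hdk
  let Λ := LinearMap.ker (bdry ℤ (cx E (k + 1)) k)
  have : AddGroup.FG Λ := Module.Finite.iff_addGroup_fg.1 inferInstance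
  have hcard : Nat.card {z : Chain ℤ (cx E (k + 1)) (k + 1) //
      bdry ℤ (cx E (k + 1)) k z = 0 ∧ castChain (cx E (k + 1)) (k + 1) z ∈ hZonotope E k} =
      (zonotopePoints (edgeCycle E k) E).ncard := by
    refine Nat.card_congr ((Equiv.subtypeSubtypeEquivSubtypeInter _ _).symm.trans
      (Equiv.subtypeEquivRight (p := fun z : Λ => castChain (cx E (k + 1)) (k + 1) z.1 ∈
        hZonotope E k) fun z => mem_hZonotope_iff_mem_zonotopePoints hE z))
  rw [hcard, (ncard_zonotopePoints E (edgeCycle E k)).2]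
  refine sum_congr rfl fun F hF => ?_
  have hF' : ∀ e ∈ F, e.card = k + 2 := fun e he => hE e (mem_powerset.1 hF he)
  simp only [ker_bdry_eq_bot_iff E hF', cardTorsionH_eq E hF']
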